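/- arXiv:2405.03031 — 3 statements merged into one kernel-verified Lean document; each statement's English description precedes it below -/
import Mathlib

section
/- Fix a natural number M ≥ 1 and a nonincreasing, nonnegative function V : ℝ → ℝ. Define h(N) = N(2M+1)/(2M(M+1)) and g(N) = 1 + 1/(2(M+1)(1 + (M/N)·V(h(N)))) for N > 0. Then g is nondecreasing on (0, ∞): for all 0 < N₁ ≤ N₂, g(N₁) ≤ g(N₂). -/
/-- Theorem 2: the CHAR PoA `g(N) = 1 + 1/(2(M+1)(1 + (M/N)·V(h(N))))` is
nondecreasing in the expected user number `N`, when `V` is nonincreasing and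
nonnegative. -/
theorem stmt_4 (M : ℕ) (hM : 1 ≤ M) (V : ℝ → ℝ)
    (hVmono : ∀ x y : ℝ, x ≤ y → V y ≤ V x) (hVnn : ∀ x : ℝ, 0 ≤ V x) :
    let h : ℝ → ℝ := fun N => N * (2 * M + 1) / (2 * M * (M + 1))
    let g : ℝ → ℝ := fun N => 1 + 1 / (2 * (M + 1) * (1 + (M / N) * V (h N)))
    ∀ N₁ N₂ : ℝ, 0 < N₁ → N₁ ≤ N₂ → g N₁ ≤ g N₂ := by
  intro h g N₁ N₂ hN₁ hN
  have hN₂ : 0 < N₂ := hN₁.trans_le hN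
  have h_mono : h N₁ ≤ h N₂ := by
    simp only [h]
    gcongr
  have h_cost : (M / N₂ : ℝ) * V (h N₂) ≤ (M / N₁ : ℝ) * V (h N₁) :=
    mul_le_mul (by gcongr) (hVmono _ _ h_mono) (hVnn _) (by positivity)
  have h_nonneg : 0 ≤ (M / N₂ : ℝ) * V (h N₂) :=
    mul_nonneg (by positivity) (hVnn _)
  simp only [g]
  gcongr
end

section
/- Fix N > 0 and a nonincreasing, nonnegative function V : ℝ → ℝ. For each natural number M ≥ 1 define g(M) = 1 + 1/(2(M+1)(1 + (M/N)·V(N(2M+1)/(2M(M+1))))). Then g is nonincreasing in M: for all natural numbers 1 ≤ M₁ ≤ M₂, g(M₂) ≤ g(M₁). -/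
/-- The expected number of users observing a path is nonincreasing in the number of paths. -/
theorem observers_antitone {N a b : ℝ} (hN : 0 ≤ N) (ha : 0 < a) (hab : a ≤ b) :
    N * (2 * b + 1) / (2 * b * (b + 1)) ≤ N * (2 * a + 1) / (2 * a * (a + 1)) := by
  have hb : 0 < b := ha.trans_le hab
  rw [mul_div_assoc, mul_div_assoc]
  refine mul_le_mul_of_nonneg_left ?_ hN
  rw [div_le_div_iff₀ (by positivity) (by positivity)]
  have h : 0 ≤ (b - a) * (2 * a * b + a + b + 1) :=
    mul_nonneg (sub_nonneg.2 hab) (by positivity)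
  linarith

/-- Theorem 2: the CHAR PoA is nonincreasing in the number of stochastic
paths `M`, when `V` is nonincreasing and nonnegative. -/
theorem stmt_7 (N : ℝ) (hN : 0 < N) (V : ℝ → ℝ)
    (hVmono : ∀ x y : ℝ, x ≤ y → V y ≤ V x) (hVnn : ∀ x : ℝ, 0 ≤ V x) :
    let g : ℕ → ℝ := fun M =>
      1 + 1 / (2 * ((M : ℝ) + 1) *
        (1 + ((M : ℝ) / N) * V (N * (2 * M + 1) / (2 * M * (M + 1)))))
    ∀ M₁ M₂ : ℕ, 1 ≤ M₁ → M₁ ≤ M₂ → g M₂ ≤ g M₁ := by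
  intro g M₁ M₂ h₁ h₁₂
  have ha : (0 : ℝ) < M₁ := by exact_mod_cast h₁
  have hab : (M₁ : ℝ) ≤ M₂ := by exact_mod_cast h₁₂
  have hV := hVmono _ _ (observers_antitone hN.le ha hab)
  have hV₁ := hVnn (N * (2 * M₁ + 1) / (2 * M₁ * (M₁ + 1)))
  dsimp only [g]
  gcongr
end

section
/- Let x, x̄ ∈ (0,1) and 0 < q_L < q_H < 1. Define the posteriors x₁' = x·q_H/(x·q_H + (1−x)·q_L) and x₀' = x·(1−q_H)/(x·(1−q_H) + (1−x)·(1−q_L)), and the true hazard-report probability P̄₁ = x̄·q_H + (1−x̄)·q_L. Then the true-state expected updated belief satisfies: if x > x̄ then P̄₁·x₁' + (1 − P̄₁)·x₀' < x, and if x < x̄ then P̄₁·x₁' + (1 − P̄₁)·x₀' > x. -/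
/-- The drift of the Bayesian posterior mean under a misspecified prior `x`, when the true
probability is `y`, is a multiple of `y - x`. -/
theorem posterior_mean_sub_prior (x y a b : ℝ) (h₁ : x * b + (1 - x) * a ≠ 0)
    (h₀ : x * (1 - b) + (1 - x) * (1 - a) ≠ 0) :
    (y * b + (1 - y) * a) * (x * b / (x * b + (1 - x) * a)) +
        (1 - (y * b + (1 - y) * a)) * (x * (1 - b) / (x * (1 - b) + (1 - x) * (1 - a))) - x =
      (y - x) * (x * (1 - x) * (b - a) ^ 2 /
        ((x * b + (1 - x) * a) * (x * (1 - b) + (1 - x) * (1 - a)))) := by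
  rw [mul_div_assoc', mul_div_assoc', mul_div_assoc', div_add_div _ _ h₁ h₀, sub_eq_iff_eq_add,
    div_add' _ _ _ (mul_ne_zero h₁ h₀)]
  congr 1
  ring

/-- Key drift step in the proof of Proposition 2: under the true hazard-report
probability, the expected updated belief moves strictly toward the real steady
state `x̄`. -/
theorem stmt_15 (x xbar qL qH : ℝ) (hx : x ∈ Set.Ioo (0 : ℝ) 1)
    (hxbar : xbar ∈ Set.Ioo (0 : ℝ) 1)
    (hqL : 0 < qL) (hLH : qL < qH) (hqH : qH < 1) :
    let x₁' : ℝ := x * qH / (x * qH + (1 - x) * qL)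
    let x₀' : ℝ := x * (1 - qH) / (x * (1 - qH) + (1 - x) * (1 - qL))
    let P₁ : ℝ := xbar * qH + (1 - xbar) * qL
    (xbar < x → P₁ * x₁' + (1 - P₁) * x₀' < x) ∧
      (x < xbar → x < P₁ * x₁' + (1 - P₁) * x₀') := by
  obtain ⟨hx0, hx1⟩ := hx
  have hx1' : 0 < 1 - x := sub_pos.2 hx1
  have hqH0 : 0 < qH := hqL.trans hLH
  have hqH' : 0 < 1 - qH := sub_pos.2 hqH
  have hqL' : 0 < 1 - qL := sub_pos.2 (hLH.trans hqH)
  have hd : 0 < qH - qL := sub_pos.2 hLH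
  have h₁ : 0 < x * qH + (1 - x) * qL := by positivity
  have h₀ : 0 < x * (1 - qH) + (1 - x) * (1 - qL) := by positivity
  have hc : 0 < x * (1 - x) * (qH - qL) ^ 2 /
      ((x * qH + (1 - x) * qL) * (x * (1 - qH) + (1 - x) * (1 - qL))) := by positivity
  have key := posterior_mean_sub_prior x xbar qL qH h₁.ne' h₀.ne'
  intro x₁' x₀' P₁
  refine ⟨fun h => sub_neg.1 ?_, fun h => sub_pos.1 ?_⟩
  · exact key.trans_lt (mul_neg_of_neg_of_pos (sub_neg.2 h) hc)
  · exact (mul_pos (sub_pos.2 h) hc).trans_eq key.symm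
end
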